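/- arXiv:2101.07464 — 3 statements merged into one kernel-verified Lean document; each statement's English description precedes it below -/
import Mathlib

section
/- Let G be an m × n random matrix with law Ginibre(m,n), and let U ∈ O(m) and V ∈ O(n) be fixed orthogonal matrices. Then U G V has law Ginibre(m,n); equivalently, the pushforward of the Ginibre(m,n) measure under the map M ↦ U M V equals the Ginibre(m,n) measure. -/
open MeasureTheory ProbabilityTheory Matrix

noncomputable section

instance matMS {m n α : Type*} [MeasurableSpace α] : MeasurableSpace (Matrix m n α) :=
  show MeasurableSpace (m → n → α) from inferInstance

/-- `sign(a) = 1` if `a ≥ 0` and `-1` otherwise. -/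
def sgn (a : ℝ) : ℝ := if 0 ≤ a then 1 else -1

/-- the `i`-th standard basis vector of `ℝ^n` (1-indexed). -/
def eVec (n i : ℕ) : Fin n → ℝ := fun a => if (a : ℕ) + 1 = i then 1 else 0

/-- the Euclidean norm on `ℝ^n`. -/
def vnorm {n : ℕ} (v : Fin n → ℝ) : ℝ := Real.sqrt (∑ i, v i ^ 2)

/-- first entry of a vector. -/
def vfirst {n : ℕ} (v : Fin n → ℝ) : ℝ := if h : 0 < n then v ⟨0, h⟩ else 0

/-- `u = v + sign(v₁) ‖v‖ e₁`. -/
def uvec {n : ℕ} (v : Fin n → ℝ) : Fin n → ℝ := v + (sgn (vfirst v) * vnorm v) • eVec n 1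

/-- the Householder reflector `H(v) = -sign(v₁) (I - 2 u uᵀ / (uᵀ u))`. -/
def householder {n : ℕ} (v : Fin n → ℝ) : Matrix (Fin n) (Fin n) ℝ :=
  (-sgn (vfirst v)) •
    ((1 : Matrix (Fin n) (Fin n) ℝ) -
      (2 / ∑ i, uvec v i ^ 2) • Matrix.vecMulVec (uvec v) (uvec v))

/-- the slice `p[K+1:n]` (with `K` entries removed from the front). -/
def vslice {n : ℕ} (K : ℕ) (p : Fin n → ℝ) : Fin (n - K) → ℝ :=
  fun i => p ⟨K + i, by have := i.isLt; omega⟩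

/-- the generalized Householder reflector `H_k(p) = diag(I_{k-1}, H(p[k:n]))`,
with the convention `H_k(p) = I` if `p[k:n] = 0`. -/
def genHouseholder {n : ℕ} (k : ℕ) (p : Fin n → ℝ) : Matrix (Fin n) (Fin n) ℝ :=
  if vslice (k - 1) p = 0 then 1
  else Matrix.of fun i j =>
    if h : k - 1 ≤ (i : ℕ) ∧ k - 1 ≤ (j : ℕ) then
      householder (vslice (k - 1) p) ⟨(i : ℕ) - (k - 1), by have := i.isLt; omega⟩
        ⟨(j : ℕ) - (k - 1), by have := j.isLt; omega⟩
    else if (i : ℕ) = (j : ℕ) then 1 else 0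

/-- `Z_i = I - e_i e_iᵀ` (1-indexed). -/
def Zmat (n i : ℕ) : Matrix (Fin n) (Fin n) ℝ := 1 - Matrix.vecMulVec (eVec n i) (eVec n i)

/-- `Z_{1:k} = Z_1 Z_2 ⋯ Z_k`. -/
def Zprod (n k : ℕ) : Matrix (Fin n) (Fin n) ℝ :=
  ((List.range k).map fun i => Zmat n (i + 1)).prod

/-- the law of a standard Gaussian random vector in `ℝ^k`. -/
def stdGaussianVec (k : ℕ) : Measure (Fin k → ℝ) :=
  Measure.pi fun _ => gaussianReal 0 1

/-- `Ginibre(m,n)`: the law of an `m × n` random matrix with i.i.d. standard normal entries. -/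
def ginibre (m n : ℕ) : Measure (Matrix (Fin m) (Fin n) ℝ) :=
  show Measure (Fin m → Fin n → ℝ) from
    Measure.pi fun _ => Measure.pi fun _ => gaussianReal 0 1

/-- `μ` is the Haar probability measure on the orthogonal group `O(n)`, characterized as a
probability measure supported on orthogonal matrices that is invariant under left
multiplication by any fixed orthogonal matrix. -/
def IsHaarOrthogonal (n : ℕ) (ν : Measure (Matrix (Fin n) (Fin n) ℝ)) : Prop :=
  IsProbabilityMeasure ν ∧ (∀ᵐ M ∂ν, Mᵀ * M = 1) ∧
    ∀ U : Matrix (Fin n) (Fin n) ℝ, Uᵀ * U = 1 → ν.map (fun M => U * M) = ν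


open scoped Kronecker

/-- An orthogonal matrix, as a linear isometry equivalence of Euclidean space. -/
def orthogonalIsometry {ι : Type*} [Fintype ι] [DecidableEq ι] (Q : Matrix ι ι ℝ)
    (hQ : Qᵀ * Q = 1) : EuclideanSpace ℝ ι ≃ₗᵢ[ℝ] EuclideanSpace ℝ ι :=
  LinearIsometry.toLinearIsometryEquiv
    { toLinearMap := Matrix.toLpLin 2 2 Q
      norm_map' := fun x => by
        have h : (Q *ᵥ x.ofLp) ⬝ᵥ (Q *ᵥ x.ofLp) = x.ofLp ⬝ᵥ x.ofLp := by
          rw [dotProduct_mulVec, ← mulVec_transpose, mulVec_mulVec, hQ, one_mulVec]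
        rw [← sq_eq_sq₀ (norm_nonneg _) (norm_nonneg _), EuclideanSpace.real_norm_sq_eq,
          EuclideanSpace.real_norm_sq_eq]
        simpa [dotProduct, sq] using h } rfl

/-- The standard Gaussian measure on `ι → ℝ` is invariant under orthogonal matrices. -/
theorem map_mulVec_pi_gaussianReal {ι : Type*} [Fintype ι] [DecidableEq ι] (Q : Matrix ι ι ℝ)
    (hQ : Qᵀ * Q = 1) :
    (Measure.pi fun _ : ι => gaussianReal 0 1).map (fun x => Q *ᵥ x) =
      Measure.pi fun _ : ι => gaussianReal 0 1 := by
  have hcomp : (fun x : ι → ℝ => Q *ᵥ x) =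
      WithLp.ofLp ∘ orthogonalIsometry Q hQ ∘ WithLp.toLp 2 := rfl
  rw [hcomp, ← Measure.map_map (by fun_prop) (by fun_prop),
    ← Measure.map_map (by fun_prop) (by fun_prop), map_pi_eq_stdGaussian, stdGaussian_map,
    ← map_pi_eq_stdGaussian, Measure.map_map (by fun_prop) (by fun_prop)]
  exact Measure.map_id

/-- `Ginibre(m,n)` is the standard Gaussian measure on `Fin m × Fin n → ℝ`, read as a matrix. -/
theorem ginibre_eq_map_curry (m n : ℕ) :
    ginibre m n = (Measure.pi fun _ : Fin m × Fin n => gaussianReal 0 1).map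
      (MeasurableEquiv.curry (Fin m) (Fin n) ℝ) := by
  have h := Measure.infinitePi_map_curry
    (fun (_ : Fin m) (_ : Fin n) => gaussianReal 0 1)
  simp only [Measure.infinitePi_eq_pi] at h
  exact h.symm

/-- If `G ~ Ginibre(m,n)` and `U ∈ O(m)`, `V ∈ O(n)` are fixed orthogonal
matrices, then `U G V ~ Ginibre(m,n)`: the pushforward of `Ginibre(m,n)` under `M ↦ U M V`
equals `Ginibre(m,n)`. -/
theorem ginibre_orthogonal_invariant {m n : ℕ}
    (U : Matrix (Fin m) (Fin m) ℝ) (hU : Uᵀ * U = 1)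
    (V : Matrix (Fin n) (Fin n) ℝ) (hV : Vᵀ * V = 1) :
    (ginibre m n).map (fun M => U * M * V) = ginibre m n := by
  have hQ : (U ⊗ₖ Vᵀ)ᵀ * (U ⊗ₖ Vᵀ) = 1 := by
    rw [← kroneckerMap_transpose, ← mul_kronecker_mul, hU, transpose_transpose,
      mul_eq_one_comm.mp hV, one_kronecker_one]
  have hmeas : Measurable fun M : Matrix (Fin m) (Fin n) ℝ => U * M * V := by
    refine measurable_pi_iff.2 fun i => measurable_pi_iff.2 fun j => ?_
    have hentry : ∀ k l, Measurable fun M : Matrix (Fin m) (Fin n) ℝ => M k l := fun k l =>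
      (measurable_pi_apply l).comp (measurable_pi_apply (X := fun _ : Fin m => Fin n → ℝ) k)
    simp only [mul_apply]
    fun_prop
  have hcomp : (fun M : Matrix (Fin m) (Fin n) ℝ => U * M * V) ∘
      MeasurableEquiv.curry (Fin m) (Fin n) ℝ =
      MeasurableEquiv.curry (Fin m) (Fin n) ℝ ∘ fun x => (U ⊗ₖ Vᵀ) *ᵥ x := by
    funext x
    have h := kronecker_mulVec_vec Vᵀ (of (Function.curry x))ᵀ U
    rw [← transpose_mul, ← transpose_mul, ← Matrix.mul_assoc] at h
    exact (congrArg Function.curry h).symm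
  have hinv := map_mulVec_pi_gaussianReal _ hQ
  rw [ginibre_eq_map_curry]
  refine (Measure.map_map hmeas (MeasurableEquiv.measurable _)).trans ?_
  refine (congrArg (fun f => Measure.map f _) hcomp).trans ?_
  refine (Measure.map_map (MeasurableEquiv.measurable _) (by fun_prop)).symm.trans ?_
  exact congrArg (Measure.map _) hinv

end
end

section
/- Let 1 ≤ k ≤ n. Let R be a random matrix taking values in O(n), let g be a standard Gaussian random vector in ℝ^m, and let G be an m × n random matrix with law Ginibre(m,n), such that g, G, and R are mutually independent. Then the random matrix (g e_kᵀ + G Z_k) R has law Ginibre(m,n), and moreover (g e_kᵀ + G Z_k) R is independent of R. -/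
open MeasureTheory ProbabilityTheory Matrix

noncomputable section

instance {n : ℕ} : IsProbabilityMeasure (stdGaussianVec n) := by
  unfold stdGaussianVec; infer_instance

instance {m n : ℕ} : IsProbabilityMeasure (ginibre m n) :=
  inferInstanceAs (IsProbabilityMeasure (Measure.pi fun _ : Fin m => stdGaussianVec n))

/-- The standard Gaussian law on `ℝⁿ` is invariant under right multiplication by an orthogonal
matrix. -/
lemma measurePreserving_vecMul_of_orthogonal {n : ℕ} {Q : Matrix (Fin n) (Fin n) ℝ}
    (hQ : Qᵀ * Q = 1) :
    MeasurePreserving (fun v : Fin n → ℝ => v ᵥ* Q) (stdGaussianVec n) (stdGaussianVec n) := by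
  have hQ' : Q * Qᵀ = 1 := mul_eq_one_comm.mp hQ
  let f : EuclideanSpace ℝ (Fin n) ≃ₗᵢ[ℝ] EuclideanSpace ℝ (Fin n) :=
    LinearIsometry.toLinearIsometryEquiv
      { toLinearMap := Matrix.toEuclideanLin Qᵀ
        norm_map' := fun x => by
          rw [EuclideanSpace.norm_eq, EuclideanSpace.norm_eq]
          congr 1
          have h : (Qᵀ *ᵥ x.ofLp) ⬝ᵥ (Qᵀ *ᵥ x.ofLp) = x.ofLp ⬝ᵥ x.ofLp := by
            rw [dotProduct_mulVec, vecMul_mulVec, transpose_transpose, ← dotProduct_mulVec,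
              hQ', one_mulVec]
          simpa [dotProduct, sq] using h } rfl
  refine ⟨by fun_prop, ?_⟩
  have hf := stdGaussian_map f
  rw [← map_pi_eq_stdGaussian, Measure.map_map (by fun_prop) (by fun_prop)] at hf
  have h := congrArg (Measure.map (WithLp.ofLp (p := 2))) hf
  rw [Measure.map_map (by fun_prop) (by fun_prop), Measure.map_map (by fun_prop) (by fun_prop)] at h
  have h₁ : (WithLp.ofLp ∘ WithLp.toLp 2 : (Fin n → ℝ) → _) = id := rfl
  rw [h₁, Measure.map_id] at h
  refine Eq.trans ?_ h
  unfold stdGaussianVec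
  congr 1
  ext v i
  simp [f, mulVec_transpose]

/-- Replacing one coordinate of a standard Gaussian vector by an independent standard Gaussian
variable preserves its law. -/
lemma measurePreserving_update_stdGaussianVec {n : ℕ} (j : Fin n) :
    MeasurePreserving (fun p : ℝ × (Fin n → ℝ) => Function.update p.2 j p.1)
      ((gaussianReal 0 1).prod (stdGaussianVec n)) (stdGaussianVec n) := by
  have hmeas : Measurable (fun p : ℝ × (Fin n → ℝ) => Function.update p.2 j p.1) := by
    refine measurable_pi_iff.mpr fun i => ?_
    by_cases h : i = j
    · subst h; simpa using measurable_fst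
    · simpa [Function.update_of_ne h] using by fun_prop
  refine ⟨hmeas, ?_⟩
  refine (Measure.pi_eq fun s hs => ?_).symm
  rw [Measure.map_apply hmeas (MeasurableSet.univ_pi hs)]
  have hpre : (fun p : ℝ × (Fin n → ℝ) => Function.update p.2 j p.1) ⁻¹' Set.univ.pi s =
      s j ×ˢ Set.univ.pi (Function.update s j Set.univ) := by
    ext p
    simp only [Set.mem_preimage, Set.mem_univ_pi, Set.mem_prod]
    refine ⟨fun h => ⟨by simpa using h j, fun i => ?_⟩, fun h i => ?_⟩
    · by_cases hi : i = j
      · subst hi; simp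
      · simpa [hi] using h i
    · by_cases hi : i = j
      · subst hi; simpa using h.1
      · simpa [hi] using h.2 i
  rw [hpre, Measure.prod_prod, stdGaussianVec, Measure.pi_pi,
    ← Finset.mul_prod_erase _ _ (Finset.mem_univ j), ← Finset.mul_prod_erase Finset.univ
      (fun i => gaussianReal 0 1 (s i)) (Finset.mem_univ j)]
  simp only [Function.update_self, measure_univ, one_mul]
  congr 1
  refine Finset.prod_congr rfl fun i hi => ?_
  rw [Function.update_of_ne (Finset.ne_of_mem_erase hi)]

lemma measurable_matrix_mul {l m n : ℕ} :
    Measurable fun p : Matrix (Fin l) (Fin m) ℝ × Matrix (Fin m) (Fin n) ℝ => p.1 * p.2 := by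
  refine measurable_pi_iff.mpr fun i => measurable_pi_iff.mpr fun j => ?_
  simp only [mul_apply]
  refine Finset.measurable_sum _ fun a _ => Measurable.mul ?_ ?_
  · exact (measurable_pi_apply a).comp ((measurable_pi_apply i).comp measurable_fst)
  · exact (measurable_pi_apply j).comp ((measurable_pi_apply a).comp measurable_snd)

/-- The Ginibre law is invariant under right multiplication by an orthogonal matrix. -/
lemma measurePreserving_mul_of_orthogonal {m n : ℕ} {Q : Matrix (Fin n) (Fin n) ℝ}
    (hQ : Qᵀ * Q = 1) :
    MeasurePreserving (fun X : Matrix (Fin m) (Fin n) ℝ => X * Q) (ginibre m n) (ginibre m n) :=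
  measurePreserving_pi (fun _ : Fin m => stdGaussianVec n) (fun _ => stdGaussianVec n)
    fun _ => measurePreserving_vecMul_of_orthogonal hQ

/-- Replacing one column of a Ginibre matrix by an independent standard Gaussian vector preserves
its law. -/
lemma measurePreserving_rank_one_update {m n k : ℕ} (hk : 1 ≤ k) (hkn : k ≤ n) :
    MeasurePreserving
      (fun p : (Fin m → ℝ) × Matrix (Fin m) (Fin n) ℝ =>
        vecMulVec p.1 (eVec n k) + p.2 * Zmat n k)
      ((stdGaussianVec m).prod (ginibre m n)) (ginibre m n) := by
  let j : Fin n := ⟨k - 1, by omega⟩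
  have he : eVec n k = Pi.single j 1 := by
    ext a
    have : (a : ℕ) + 1 = k ↔ a = j := by
      rw [Fin.ext_iff]; change _ ↔ (a : ℕ) = k - 1; omega
    simp [eVec, this, Pi.single_apply]
  have hupdate : MeasurePreserving
      (fun (q : Fin m → ℝ × (Fin n → ℝ)) i => Function.update (q i).2 j (q i).1)
      (Measure.pi fun _ => (gaussianReal 0 1).prod (stdGaussianVec n))
      (Measure.pi fun _ => stdGaussianVec n) :=
    measurePreserving_pi _ _ fun _ => measurePreserving_update_stdGaussianVec j
  have hzip := (measurePreserving_arrowProdEquivProdArrow ℝ (Fin n → ℝ) (Fin m)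
    (fun _ => gaussianReal 0 1) (fun _ => stdGaussianVec n)).symm
  have hcomp := hupdate.comp hzip
  have hentry (v : Fin m → ℝ) (X : Matrix (Fin m) (Fin n) ℝ) (i : Fin m) (a : Fin n) :
      (vecMulVec v (eVec n k) + X * Zmat n k) i a = Function.update (X i) j (v i) a := by
    rw [Zmat, Matrix.mul_sub, Matrix.mul_one, mul_vecMulVec, he]
    by_cases ha : a = j
    · subst ha; simp [vecMulVec_apply]
    · simp [vecMulVec_apply, ha]
  have hfun : (fun p : (Fin m → ℝ) × Matrix (Fin m) (Fin n) ℝ =>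
      vecMulVec p.1 (eVec n k) + p.2 * Zmat n k) =
      fun p i => Function.update (p.2 i) j (p.1 i) :=
    funext fun p => funext fun i => funext fun a => hentry p.1 p.2 i a
  rw [hfun]
  exact hcomp

/-- Let `1 ≤ k ≤ n`. Let `R` be a random matrix taking values in `O(n)`,
`g` a standard Gaussian vector in `ℝ^m`, and `G ~ Ginibre(m,n)`, with `g`, `G`, `R` mutually
independent (expressed as: `g ⫫ G` and `(g, G) ⫫ R`). Then `(g e_kᵀ + G Z_k) R ~ Ginibre(m,n)`
and, moreover, `(g e_kᵀ + G Z_k) R` is independent of `R`. -/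
theorem ginibre_rank_one_update_rotated {m n k : ℕ} (hk : 1 ≤ k) (hkn : k ≤ n)
    {Ω : Type} [MeasurableSpace Ω] (μ : Measure Ω) [IsProbabilityMeasure μ]
    (g : Ω → Fin m → ℝ) (G : Ω → Matrix (Fin m) (Fin n) ℝ) (R : Ω → Matrix (Fin n) (Fin n) ℝ)
    (hgmeas : Measurable g) (hGmeas : Measurable G) (hRmeas : Measurable R)
    (hglaw : μ.map g = stdGaussianVec m)
    (hGlaw : μ.map G = ginibre m n)
    (hR : ∀ ω, (R ω)ᵀ * R ω = 1)
    (hindep₁ : IndepFun g G μ)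
    (hindep₂ : IndepFun (fun ω => (g ω, G ω)) R μ) :
    μ.map (fun ω => (Matrix.vecMulVec (g ω) (eVec n k) + G ω * Zmat n k) * R ω) = ginibre m n ∧
      IndepFun (fun ω => (Matrix.vecMulVec (g ω) (eVec n k) + G ω * Zmat n k) * R ω) R μ := by
  have hlaw : MeasurePreserving (fun ω => (R ω, vecMulVec (g ω) (eVec n k) + G ω * Zmat n k)) μ
      ((μ.map R).prod (ginibre m n)) := by
    have hjoint : MeasurePreserving (fun ω => (g ω, G ω)) μ
        ((stdGaussianVec m).prod (ginibre m n)) := by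
      refine ⟨hgmeas.prodMk hGmeas, ?_⟩
      rw [(indepFun_iff_map_prod_eq_prod_map_map hgmeas.aemeasurable hGmeas.aemeasurable).mp
        hindep₁, hglaw, hGlaw]
    have hX := (measurePreserving_rank_one_update hk hkn).comp hjoint
    refine ⟨hRmeas.prodMk hX.measurable, ?_⟩
    have hind := (hindep₂.comp (measurePreserving_rank_one_update hk hkn).measurable
      measurable_id).symm
    rw [← hX.map_eq]
    exact (indepFun_iff_map_prod_eq_prod_map_map hRmeas.aemeasurable
      hX.measurable.aemeasurable).mp hind
  have : IsProbabilityMeasure (μ.map R) := Measure.isProbabilityMeasure_map hRmeas.aemeasurable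
  have horth : ∀ᵐ Q ∂μ.map R, (ginibre m n).map (fun X => X * Q) = ginibre m n := by
    have hset : MeasurableSet {Q : Matrix (Fin n) (Fin n) ℝ | Qᵀ * Q = 1} := by
      have : Measurable fun Q : Matrix (Fin n) (Fin n) ℝ => Qᵀ * Q := by
        refine measurable_matrix_mul.comp (Measurable.prodMk ?_ measurable_id)
        refine measurable_pi_iff.mpr fun i => measurable_pi_iff.mpr fun j => ?_
        exact (measurable_pi_apply i).comp (measurable_pi_apply j)
      exact this (measurableSet_singleton (α := Fin n → Fin n → ℝ)
        (1 : Matrix (Fin n) (Fin n) ℝ))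
    filter_upwards [(ae_map_iff hRmeas.aemeasurable hset).mpr (ae_of_all _ hR)] with Q hQ
    exact (measurePreserving_mul_of_orthogonal hQ).map_eq
  have hrot := (MeasurePreserving.skew_product (MeasurePreserving.id (μ.map R))
    (g := fun Q X => X * Q) (measurable_matrix_mul.comp measurable_swap) horth).comp hlaw
  have hXR := measurePreserving_snd.comp hrot
  refine ⟨hXR.map_eq, ?_⟩
  refine IndepFun.symm <| (indepFun_iff_map_prod_eq_prod_map_map hRmeas.aemeasurable
    hXR.measurable.aemeasurable).mpr ?_
  exact hrot.map_eq.trans (congrArg _ hXR.map_eq.symm)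

end
end

section
/- (Haar factorization lemma) Let n ≥ 2. Let g be a standard Gaussian random vector in ℝ^n, let Q_{n−1} be a random matrix with law Haar(n−1), and let v be a random vector in ℝ^n that is almost surely nonzero, with g, Q_{n−1}, and v mutually independent. Then the random matrix H₁(g) · diag(1, Q_{n−1}) · H₁(v) has law Haar(n), where diag(1, Q_{n−1}) denotes the n × n block-diagonal matrix with upper-left block the scalar 1 and lower-right block Q_{n−1}. -/
open MeasureTheory ProbabilityTheory Matrix

noncomputable section

/-- the `n × n` block-diagonal matrix `diag(1, Q)` for an `(n-1) × (n-1)` matrix `Q`. -/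
def diagOneBlock {n : ℕ} (Q : Matrix (Fin (n - 1)) (Fin (n - 1)) ℝ) :
    Matrix (Fin n) (Fin n) ℝ :=
  Matrix.of fun i j =>
    if h : 1 ≤ (i : ℕ) ∧ 1 ≤ (j : ℕ) then
      Q ⟨(i : ℕ) - 1, by have := i.isLt; omega⟩ ⟨(j : ℕ) - 1, by have := j.isLt; omega⟩
    else if (i : ℕ) = (j : ℕ) then 1 else 0

lemma measurable_matrix_iff {α m n : Type*} [MeasurableSpace α] {f : α → Matrix m n ℝ} :
    Measurable f ↔ ∀ i j, Measurable fun x => f x i j := by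
  have h1 : Measurable f ↔ ∀ i, Measurable fun x => f x i :=
    measurable_pi_iff (X := fun _ : m => n → ℝ) (g := f)
  rw [h1]
  exact forall_congr' fun i => measurable_pi_iff (X := fun _ : n => ℝ) (g := fun x => f x i)

lemma Measurable.matrix_apply {α m n : Type*} [MeasurableSpace α] {f : α → Matrix m n ℝ}
    (hf : Measurable f) (i : m) (j : n) : Measurable fun x => f x i j :=
  measurable_matrix_iff.1 hf i j

lemma Measurable.matrix_mul_matrix {α l m n : Type*} [MeasurableSpace α] [Fintype m]
    {f : α → Matrix l m ℝ} {g : α → Matrix m n ℝ} (hf : Measurable f) (hg : Measurable g) :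
    Measurable fun x => f x * g x := by
  refine measurable_matrix_iff.2 fun i j => ?_
  simp only [Matrix.mul_apply]
  exact Finset.measurable_sum _ fun k _ => (hf.matrix_apply i k).mul (hg.matrix_apply k j)

lemma Measurable.matrix_transpose_matrix {α m n : Type*} [MeasurableSpace α]
    {f : α → Matrix m n ℝ} (hf : Measurable f) : Measurable fun x => (f x)ᵀ :=
  measurable_matrix_iff.2 fun i j => hf.matrix_apply j i

lemma measurable_mulVec_const {m n : Type*} [Fintype n] (U : Matrix m n ℝ) :
    Measurable fun v : n → ℝ => U *ᵥ v := by
  refine measurable_pi_iff.2 fun i => ?_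
  simp only [Matrix.mulVec, dotProduct]
  exact Finset.measurable_sum _ fun k _ => (measurable_pi_apply k).const_mul _

lemma measurableSet_transpose_mul_self_eq_one {n : ℕ} :
    MeasurableSet {M : Matrix (Fin n) (Fin n) ℝ | Mᵀ * M = 1} := by
  have h : {M : Matrix (Fin n) (Fin n) ℝ | Mᵀ * M = 1} =
      ⋂ i, ⋂ j, {M | (Mᵀ * M) i j = (1 : Matrix (Fin n) (Fin n) ℝ) i j} := by
    ext M
    simp only [Set.mem_ofPred_eq, Set.mem_iInter]
    exact ⟨fun h i j => by rw [h], fun h => Matrix.ext h⟩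
  rw [h]
  refine MeasurableSet.iInter fun i => MeasurableSet.iInter fun j => ?_
  exact measurableSet_eq_fun
    ((measurable_id.matrix_transpose_matrix.matrix_mul_matrix measurable_id).matrix_apply i j)
    measurable_const

lemma sgn_mul_self (a : ℝ) : sgn a * sgn a = 1 := by
  unfold sgn; split_ifs <;> norm_num

lemma sgn_mul_nonneg (a : ℝ) : 0 ≤ sgn a * a := by
  unfold sgn; split_ifs <;> linarith

lemma measurable_sgn : Measurable sgn :=
  Measurable.ite measurableSet_Ici measurable_const measurable_const

lemma vnorm_sq {n : ℕ} (v : Fin n → ℝ) : vnorm v ^ 2 = ∑ i, v i ^ 2 :=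
  Real.sq_sqrt (Finset.sum_nonneg fun i _ => sq_nonneg (v i))

lemma vnorm_pos {n : ℕ} {v : Fin n → ℝ} (hv : v ≠ 0) : 0 < vnorm v := by
  obtain ⟨i, hi⟩ := Function.ne_iff.1 hv
  exact Real.sqrt_pos.2 (Finset.sum_pos' (fun j _ => sq_nonneg (v j))
    ⟨i, Finset.mem_univ i, sq_pos_of_ne_zero hi⟩)

lemma eVec_one_apply {n : ℕ} (i : Fin (n + 1)) : eVec (n + 1) 1 i = if i = 0 then 1 else 0 := by
  simp only [eVec, Fin.ext_iff, Fin.val_zero, Nat.add_eq_right]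

lemma vfirst_succ {n : ℕ} (v : Fin (n + 1) → ℝ) : vfirst v = v 0 := by
  simp [vfirst]

lemma uvec_apply {n : ℕ} (v : Fin (n + 1) → ℝ) (i : Fin (n + 1)) :
    uvec v i = v i + sgn (v 0) * vnorm v * if i = 0 then 1 else 0 := by
  simp [uvec, eVec_one_apply, vfirst_succ]

lemma sum_uvec_sq {n : ℕ} (v : Fin (n + 1) → ℝ) :
    ∑ i, uvec v i ^ 2 = 2 * vnorm v * (vnorm v + sgn (v 0) * v 0) := by
  have h : ∀ i, uvec v i ^ 2 = v i ^ 2 + (if i = 0 then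
      2 * (sgn (v 0) * vnorm v) * v 0 + (sgn (v 0) * sgn (v 0)) * vnorm v ^ 2 else 0) := by
    intro i
    rw [uvec_apply]
    split_ifs with hi
    · subst hi; ring
    · ring
  simp only [h, Finset.sum_add_distrib, Finset.sum_ite_eq', Finset.mem_univ, if_true,
    sgn_mul_self, ← vnorm_sq]
  ring

lemma sum_uvec_sq_pos {n : ℕ} {v : Fin (n + 1) → ℝ} (hv : v ≠ 0) : 0 < ∑ i, uvec v i ^ 2 := by
  rw [sum_uvec_sq]
  have := vnorm_pos hv
  have := sgn_mul_nonneg (v 0)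
  positivity

lemma householder_transpose_mul_self {n : ℕ} {v : Fin (n + 1) → ℝ} (hv : v ≠ 0) :
    (householder v)ᵀ * householder v = 1 := by
  have hpos := sum_uvec_sq_pos hv
  have hs := sgn_mul_self (vfirst v)
  have hdot : uvec v ⬝ᵥ uvec v = ∑ i, uvec v i ^ 2 := by simp [dotProduct, sq]
  simp only [householder]
  rw [Matrix.transpose_smul, Matrix.transpose_sub, Matrix.transpose_smul,
    Matrix.transpose_vecMulVec, Matrix.transpose_one, Matrix.smul_mul, Matrix.mul_smul,
    smul_smul, neg_mul_neg, hs, one_smul]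
  simp only [sub_mul, mul_sub, one_mul, mul_one, Matrix.smul_mul, Matrix.mul_smul,
    Matrix.vecMulVec_mul_vecMulVec, hdot, smul_smul, Matrix.vecMulVec_smul]
  ext i j
  simp only [Matrix.sub_apply, Matrix.smul_apply, smul_eq_mul]
  field_simp
  ring

lemma householder_apply_zero {n : ℕ} {v : Fin (n + 1) → ℝ} (hv : v ≠ 0) (i : Fin (n + 1)) :
    householder v i 0 = (vnorm v)⁻¹ * v i := by
  have hN := vnorm_pos hv
  have hq := sgn_mul_nonneg (v 0)
  have hs := sgn_mul_self (v 0)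
  have hne : vnorm v + sgn (v 0) * v 0 ≠ 0 := by positivity
  have hc : 2 / (∑ i, uvec v i ^ 2) * uvec v 0 = sgn (v 0) / vnorm v := by
    rw [sum_uvec_sq, uvec_apply]
    simp only [if_true, mul_one]
    have : v 0 + sgn (v 0) * vnorm v = sgn (v 0) * (vnorm v + sgn (v 0) * v 0) := by
      linear_combination (-v 0) * hs
    rw [this]
    field_simp
  have he : householder v i 0 = -sgn (v 0) * ((if i = 0 then 1 else 0) -
      (2 / (∑ i, uvec v i ^ 2) * uvec v 0) * uvec v i) := by
    simp only [householder, vfirst_succ, Matrix.smul_apply, Matrix.sub_apply, Matrix.one_apply,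
      Matrix.vecMulVec_apply, smul_eq_mul]
    ring
  rw [he, hc, uvec_apply]
  field_simp
  linear_combination (v i + sgn (v 0) * vnorm v * (if i = 0 then 1 else 0)) * hs

lemma householder_apply_of_cast {m n : ℕ} (h : m = n) {w : Fin m → ℝ} {v : Fin n → ℝ}
    (hw : ∀ i, w i = v (Fin.cast h i)) (i j : Fin m) :
    householder w i j = householder v (Fin.cast h i) (Fin.cast h j) := by
  subst h
  obtain rfl : w = v := funext hw
  rfl

lemma genHouseholder_one {n : ℕ} (v : Fin n → ℝ) :
    genHouseholder 1 v = if v = 0 then 1 else householder v := by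
  have hn : n - (1 - 1) = n := by omega
  have hw : ∀ i, vslice (1 - 1) v i = v (Fin.cast hn i) := fun i => by
    simp only [vslice]
    congr 1
    ext
    simp
  have h0 : vslice (1 - 1) v = 0 ↔ v = 0 := by
    refine ⟨fun h => funext fun i => ?_, fun h => funext fun i => by rw [hw, h]; rfl⟩
    exact (hw (Fin.cast hn.symm i)).symm.trans (congrFun h _)
  ext i j
  by_cases hv : v = 0
  · simp only [genHouseholder, if_pos hv, if_pos (h0.2 hv)]
  · simp only [genHouseholder, if_neg hv, if_neg (mt h0.1 hv), Matrix.of_apply]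
    rw [dif_pos ⟨by omega, by omega⟩, householder_apply_of_cast hn hw]
    simp

lemma genHouseholder_one_transpose_mul_self {n : ℕ} (v : Fin (n + 1) → ℝ) :
    (genHouseholder 1 v)ᵀ * genHouseholder 1 v = 1 := by
  rw [genHouseholder_one]
  split_ifs with h
  · simp
  · exact householder_transpose_mul_self h

lemma genHouseholder_one_mulVec_single {n : ℕ} {v : Fin (n + 1) → ℝ} (hv : v ≠ 0) :
    genHouseholder 1 v *ᵥ Pi.single 0 1 = (vnorm v)⁻¹ • v := by
  rw [genHouseholder_one, if_neg hv]
  ext i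
  simp [householder_apply_zero hv]

lemma measurable_vnorm {n : ℕ} : Measurable (vnorm : (Fin n → ℝ) → ℝ) :=
  (Finset.measurable_sum _ fun i _ => (measurable_pi_apply i).pow_const 2).sqrt

lemma measurable_uvec_apply {n : ℕ} (i : Fin (n + 1)) :
    Measurable fun v : Fin (n + 1) → ℝ => uvec v i := by
  simp only [uvec_apply]
  exact (measurable_pi_apply i).add
    (((measurable_sgn.comp (measurable_pi_apply 0)).mul measurable_vnorm).mul_const _)

lemma measurable_householder {n : ℕ} :
    Measurable (householder : (Fin (n + 1) → ℝ) → Matrix (Fin (n + 1)) (Fin (n + 1)) ℝ) := by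
  refine measurable_matrix_iff.2 fun i j => ?_
  simp only [householder, vfirst_succ, Matrix.smul_apply, Matrix.sub_apply,
    Matrix.vecMulVec_apply, smul_eq_mul]
  have hs : Measurable fun v : Fin (n + 1) → ℝ => ∑ i, uvec v i ^ 2 :=
    Finset.measurable_sum _ fun i _ => (measurable_uvec_apply i).pow_const 2
  exact (measurable_sgn.comp (measurable_pi_apply 0)).neg.mul (measurable_const.sub
    ((measurable_const.div hs).mul ((measurable_uvec_apply i).mul (measurable_uvec_apply j))))

lemma measurable_genHouseholder_one {n : ℕ} :
    Measurable (genHouseholder 1 : (Fin (n + 1) → ℝ) → Matrix (Fin (n + 1)) (Fin (n + 1)) ℝ) := by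
  have h : (genHouseholder 1 : (Fin (n + 1) → ℝ) → Matrix (Fin (n + 1)) (Fin (n + 1)) ℝ) =
      fun v => if v = 0 then 1 else householder v := funext genHouseholder_one
  rw [h]
  exact Measurable.ite (measurableSet_singleton 0) measurable_const measurable_householder

section DiagOneBlock

variable {n : ℕ} (Q R : Matrix (Fin n) (Fin n) ℝ)

lemma diagOneBlock_zero_zero : diagOneBlock (n := n + 1) Q 0 0 = 1 := by
  simp [diagOneBlock]

lemma diagOneBlock_zero_succ (j : Fin n) : diagOneBlock (n := n + 1) Q 0 j.succ = 0 := by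
  simp [diagOneBlock]

lemma diagOneBlock_succ_zero (i : Fin n) : diagOneBlock (n := n + 1) Q i.succ 0 = 0 := by
  simp [diagOneBlock]

lemma diagOneBlock_succ_succ (i j : Fin n) :
    diagOneBlock (n := n + 1) Q i.succ j.succ = Q i j := by
  simp [diagOneBlock]

lemma diagOneBlock_mul :
    diagOneBlock (n := n + 1) Q * diagOneBlock (n := n + 1) R =
      diagOneBlock (n := n + 1) (Q * R) := by
  ext i j
  rw [Matrix.mul_apply, Fin.sum_univ_succ]
  refine Fin.cases ?_ (fun i => ?_) i <;> refine Fin.cases ?_ (fun j => ?_) j <;>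
    simp only [diagOneBlock_zero_zero, diagOneBlock_zero_succ, diagOneBlock_succ_zero,
      diagOneBlock_succ_succ, mul_zero, zero_mul, mul_one, Finset.sum_const_zero, add_zero,
      zero_add, Matrix.mul_apply]

lemma diagOneBlock_transpose :
    (diagOneBlock (n := n + 1) Q)ᵀ = diagOneBlock (n := n + 1) Qᵀ := by
  ext i j
  rw [Matrix.transpose_apply]
  refine Fin.cases ?_ (fun i => ?_) i <;> refine Fin.cases ?_ (fun j => ?_) j <;>
    simp only [diagOneBlock_zero_zero, diagOneBlock_zero_succ, diagOneBlock_succ_zero,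
      diagOneBlock_succ_succ, Matrix.transpose_apply]

lemma diagOneBlock_one : diagOneBlock (n := n + 1) (1 : Matrix (Fin n) (Fin n) ℝ) = 1 := by
  ext i j
  refine Fin.cases ?_ (fun i => ?_) i <;> refine Fin.cases ?_ (fun j => ?_) j <;>
    simp [diagOneBlock_zero_zero, diagOneBlock_zero_succ, diagOneBlock_succ_zero,
      diagOneBlock_succ_succ, Matrix.one_apply, Fin.succ_ne_zero, (Fin.succ_ne_zero _).symm]

lemma diagOneBlock_injective
    (h : diagOneBlock (n := n + 1) Q = diagOneBlock (n := n + 1) R) : Q = R := by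
  ext i j
  rw [← diagOneBlock_succ_succ Q, h, diagOneBlock_succ_succ R]

lemma measurable_diagOneBlock :
    Measurable (fun Q : Matrix (Fin n) (Fin n) ℝ => diagOneBlock (n := n + 1) Q) := by
  refine measurable_matrix_iff.2 fun i j => ?_
  refine Fin.cases ?_ (fun i => ?_) i <;> refine Fin.cases ?_ (fun j => ?_) j <;>
    simp only [diagOneBlock_zero_zero, diagOneBlock_zero_succ, diagOneBlock_succ_zero,
      diagOneBlock_succ_succ]
  · exact measurable_const
  · exact measurable_const
  · exact measurable_const
  · exact measurable_id.matrix_apply i j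

/-- An orthogonal matrix fixing the first basis vector is block diagonal. -/
lemma eq_diagOneBlock_of_mulVec_single {M : Matrix (Fin (n + 1)) (Fin (n + 1)) ℝ}
    (hM : Mᵀ * M = 1) (h1 : M *ᵥ Pi.single 0 1 = Pi.single 0 1) :
    M = diagOneBlock (n := n + 1) (M.submatrix Fin.succ Fin.succ) := by
  have hcol : ∀ i, M i 0 = (Pi.single 0 1 : Fin (n + 1) → ℝ) i := fun i => by
    simpa using congrFun h1 i
  have hrow : ∀ j : Fin n, M 0 j.succ = 0 := fun j => by
    have := congrFun (congrFun hM 0) j.succ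
    rw [Matrix.mul_apply, Fin.sum_univ_succ] at this
    simpa [hcol, Matrix.one_apply, (Fin.succ_ne_zero _).symm] using this
  ext i j
  refine Fin.cases ?_ (fun i => ?_) i <;> refine Fin.cases ?_ (fun j => ?_) j <;>
    simp [diagOneBlock_zero_zero, diagOneBlock_zero_succ, diagOneBlock_succ_zero,
      diagOneBlock_succ_succ, hcol, hrow]

end DiagOneBlock

lemma dotProduct_mulVec_self_of_transpose_mul_self {n : ℕ} {U : Matrix (Fin n) (Fin n) ℝ}
    (hU : Uᵀ * U = 1) (v : Fin n → ℝ) : (U *ᵥ v) ⬝ᵥ (U *ᵥ v) = v ⬝ᵥ v := by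
  rw [Matrix.dotProduct_mulVec, Matrix.vecMul_mulVec, ← Matrix.dotProduct_mulVec,
    hU, Matrix.one_mulVec]

lemma sum_sq_mulVec {n : ℕ} {U : Matrix (Fin n) (Fin n) ℝ}
    (hU : Uᵀ * U = 1) (v : Fin n → ℝ) : ∑ i, (U *ᵥ v) i ^ 2 = ∑ i, v i ^ 2 := by
  simpa [dotProduct, sq] using dotProduct_mulVec_self_of_transpose_mul_self hU v

lemma vnorm_mulVec {n : ℕ} {U : Matrix (Fin n) (Fin n) ℝ}
    (hU : Uᵀ * U = 1) (v : Fin n → ℝ) : vnorm (U *ᵥ v) = vnorm v := by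
  rw [vnorm, vnorm, sum_sq_mulVec hU]

lemma transpose_mul_self_mul {n : ℕ} {A B : Matrix (Fin n) (Fin n) ℝ}
    (hA : Aᵀ * A = 1) (hB : Bᵀ * B = 1) : (A * B)ᵀ * (A * B) = 1 := by
  rw [Matrix.transpose_mul, Matrix.mul_assoc, ← Matrix.mul_assoc Aᵀ, hA, Matrix.one_mul, hB]

/-- The standard Gaussian law is invariant under orthogonal matrices. -/
lemma stdGaussianVec_map_mulVec {n : ℕ} {U : Matrix (Fin n) (Fin n) ℝ} (hU : Uᵀ * U = 1) :
    (stdGaussianVec n).map (fun v => U *ᵥ v) = stdGaussianVec n := by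
  let L : EuclideanSpace ℝ (Fin n) →ₗᵢ[ℝ] EuclideanSpace ℝ (Fin n) :=
    { toLinearMap := Matrix.toEuclideanLin U
      norm_map' := fun x => by
        simp [EuclideanSpace.norm_eq, Matrix.toEuclideanLin, sum_sq_mulVec hU] }
  have h := stdGaussian_map (L.toLinearIsometryEquiv rfl)
  have hto : Measurable (WithLp.toLp 2 : (Fin n → ℝ) → EuclideanSpace ℝ (Fin n)) := by fun_prop
  have hof : Measurable (WithLp.ofLp : EuclideanSpace ℝ (Fin n) → (Fin n → ℝ)) := by fun_prop
  rw [← map_pi_eq_stdGaussian, Measure.map_map (by fun_prop) hto] at h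
  have h2 := congrArg (Measure.map WithLp.ofLp) h
  rw [Measure.map_map hof (by fun_prop), Measure.map_map hof hto] at h2
  have e1 : (WithLp.ofLp ∘ (L.toLinearIsometryEquiv rfl) ∘ WithLp.toLp 2) =
      fun v : Fin n → ℝ => U *ᵥ v := rfl
  have e2 : (WithLp.ofLp ∘ WithLp.toLp 2) = (id : (Fin n → ℝ) → (Fin n → ℝ)) := rfl
  rw [e1, e2, Measure.map_id] at h2
  exact h2

lemma stdGaussianVec_ae_ne_zero (n : ℕ) : ∀ᵐ g ∂stdGaussianVec (n + 1), g ≠ 0 := by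
  have : NullSingletonClass (gaussianReal 0 1) := nullSingletonClass_gaussianReal one_ne_zero
  have h : NullSingletonClass (stdGaussianVec (n + 1)) := by
    unfold stdGaussianVec; infer_instance
  exact Measure.ae_ne _ 0

instance isProbabilityMeasure_stdGaussianVec (n : ℕ) :
    IsProbabilityMeasure (stdGaussianVec n) := by
  unfold stdGaussianVec; infer_instance

/-- The lower-right block of the orthogonal matrix `H₁(U g)ᵀ U H₁(g)`. -/
def householderBlock {n : ℕ} (U : Matrix (Fin (n + 1)) (Fin (n + 1)) ℝ) (g : Fin (n + 1) → ℝ) :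
    Matrix (Fin n) (Fin n) ℝ :=
  ((genHouseholder 1 (U *ᵥ g))ᵀ * (U * genHouseholder 1 g)).submatrix Fin.succ Fin.succ

section HouseholderBlock

variable {n : ℕ} {U : Matrix (Fin (n + 1)) (Fin (n + 1)) ℝ} {g : Fin (n + 1) → ℝ}

lemma diagOneBlock_householderBlock (hU : Uᵀ * U = 1) (hg : g ≠ 0) :
    diagOneBlock (n := n + 1) (householderBlock U g) =
      (genHouseholder 1 (U *ᵥ g))ᵀ * (U * genHouseholder 1 g) := by
  have hA := genHouseholder_one_transpose_mul_self (U *ᵥ g)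
  have hUg : U *ᵥ g ≠ 0 := fun h => hg <| by
    simpa [Matrix.mulVec_mulVec, hU] using congrArg (Uᵀ *ᵥ ·) h
  refine (eq_diagOneBlock_of_mulVec_single ?_ ?_).symm
  · refine transpose_mul_self_mul ?_
      (transpose_mul_self_mul hU (genHouseholder_one_transpose_mul_self g))
    rw [Matrix.transpose_transpose, mul_eq_one_comm]
    exact hA
  · rw [← Matrix.mulVec_mulVec, ← Matrix.mulVec_mulVec, genHouseholder_one_mulVec_single hg,
      Matrix.mulVec_smul, ← vnorm_mulVec hU g, ← genHouseholder_one_mulVec_single hUg,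
      Matrix.mulVec_mulVec, hA, Matrix.one_mulVec]

lemma householderBlock_transpose_mul_self (hU : Uᵀ * U = 1) (hg : g ≠ 0) :
    (householderBlock U g)ᵀ * householderBlock U g = 1 := by
  apply diagOneBlock_injective
  rw [← diagOneBlock_mul, ← diagOneBlock_transpose, diagOneBlock_householderBlock hU hg,
    diagOneBlock_one]
  refine transpose_mul_self_mul ?_
    (transpose_mul_self_mul hU (genHouseholder_one_transpose_mul_self g))
  rw [Matrix.transpose_transpose, mul_eq_one_comm]
  exact genHouseholder_one_transpose_mul_self _

lemma genHouseholder_mul_diagOneBlock_householderBlock (hU : Uᵀ * U = 1) (hg : g ≠ 0) :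
    genHouseholder 1 (U *ᵥ g) * diagOneBlock (n := n + 1) (householderBlock U g) =
      U * genHouseholder 1 g := by
  rw [diagOneBlock_householderBlock hU hg, ← Matrix.mul_assoc,
    mul_eq_one_comm.1 (genHouseholder_one_transpose_mul_self (U *ᵥ g)), Matrix.one_mul]

lemma measurable_householderBlock (U : Matrix (Fin (n + 1)) (Fin (n + 1)) ℝ) :
    Measurable (householderBlock U) := by
  have h : Measurable fun g : Fin (n + 1) → ℝ =>
      (genHouseholder 1 (U *ᵥ g))ᵀ * (U * genHouseholder 1 g) :=
    (measurable_genHouseholder_one.comp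
      (measurable_mulVec_const U)).matrix_transpose_matrix.matrix_mul_matrix
        (measurable_const.matrix_mul_matrix measurable_genHouseholder_one)
  exact measurable_matrix_iff.2 fun i j => h.matrix_apply i.succ j.succ

/-- The change of variables `(g, Q, v) ↦ (U g, W(g) Q, v)` preserves the joint law. -/
lemma measurePreserving_householderBlock {ν : Measure (Matrix (Fin n) (Fin n) ℝ)}
    (hν : IsHaarOrthogonal n ν) (κ : Measure (Fin (n + 1) → ℝ)) [IsProbabilityMeasure κ]
    (hU : Uᵀ * U = 1) :
    MeasurePreserving (fun p : ((Fin (n + 1) → ℝ) × Matrix (Fin n) (Fin n) ℝ) ×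
        (Fin (n + 1) → ℝ) => ((U *ᵥ p.1.1, householderBlock U p.1.1 * p.1.2), p.2))
      (((stdGaussianVec (n + 1)).prod ν).prod κ) (((stdGaussianVec (n + 1)).prod ν).prod κ) := by
  have := hν.1
  refine MeasurePreserving.prod (f := fun q : (Fin (n + 1) → ℝ) × Matrix (Fin n) (Fin n) ℝ =>
      (U *ᵥ q.1, householderBlock U q.1 * q.2)) (g := id) ?_ (MeasurePreserving.id κ)
  refine MeasurePreserving.skew_product (f := fun g : Fin (n + 1) → ℝ => U *ᵥ g)
    (g := fun g Q => householderBlock U g * Q)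
    ⟨measurable_mulVec_const U, stdGaussianVec_map_mulVec hU⟩ ?_ ?_
  · exact ((measurable_householderBlock U).comp measurable_fst).matrix_mul_matrix measurable_snd
  · filter_upwards [stdGaussianVec_ae_ne_zero n] with g hg
    exact hν.2.2 _ (householderBlock_transpose_mul_self hU hg)

end HouseholderBlock

/-- **Haar factorization lemma.** Let `n ≥ 2`, let `g` be a standard Gaussian
vector in `ℝ^n`, `Q_{n-1} ~ Haar(n-1)`, and `v` a random vector in `ℝ^n` that is almost surely
nonzero, all mutually independent (modelled on the product probability space). Then
`H₁(g) ⬝ diag(1, Q_{n-1}) ⬝ H₁(v)` has law `Haar(n)`. -/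
theorem haar_factorization {n : ℕ} (hn : 2 ≤ n)
    (ν : Measure (Matrix (Fin (n - 1)) (Fin (n - 1)) ℝ)) (hν : IsHaarOrthogonal (n - 1) ν)
    (κ : Measure (Fin n → ℝ)) (hκprob : IsProbabilityMeasure κ) (hκ : ∀ᵐ v ∂κ, v ≠ 0) :
    IsHaarOrthogonal n
      (((((stdGaussianVec n).prod ν).prod κ)).map
        (fun p => genHouseholder 1 p.1.1 * diagOneBlock p.1.2 * genHouseholder 1 p.2)) := by
  obtain ⟨n, rfl⟩ : ∃ m, n = m + 1 := ⟨n - 1, by omega⟩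
  change Measure (Matrix (Fin n) (Fin n) ℝ) at ν
  change IsHaarOrthogonal n ν at hν
  have := hν.1
  set F : ((Fin (n + 1) → ℝ) × Matrix (Fin n) (Fin n) ℝ) × (Fin (n + 1) → ℝ) →
      Matrix (Fin (n + 1)) (Fin (n + 1)) ℝ := fun p =>
    genHouseholder 1 p.1.1 * diagOneBlock (n := n + 1) p.1.2 * genHouseholder 1 p.2
  set P := ((stdGaussianVec (n + 1)).prod ν).prod κ
  have hF : Measurable F :=
    ((measurable_genHouseholder_one.comp (measurable_fst.comp measurable_fst)).matrix_mul_matrix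
      (measurable_diagOneBlock.comp (measurable_snd.comp measurable_fst))).matrix_mul_matrix
        (measurable_genHouseholder_one.comp measurable_snd)
  change IsHaarOrthogonal (n + 1) (P.map F)
  refine ⟨Measure.isProbabilityMeasure_map hF.aemeasurable, ?_, fun U hU => ?_⟩
  · rw [ae_map_iff hF.aemeasurable measurableSet_transpose_mul_self_eq_one]
    have h : ∀ᵐ q ∂(stdGaussianVec (n + 1)).prod ν, q.2ᵀ * q.2 = 1 :=
      Measure.quasiMeasurePreserving_snd.ae hν.2.1
    have h' : ∀ᵐ p ∂P, p.1.2ᵀ * p.1.2 = 1 := Measure.quasiMeasurePreserving_fst.ae h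
    filter_upwards [h'] with p hp
    refine transpose_mul_self_mul (transpose_mul_self_mul
      (genHouseholder_one_transpose_mul_self _) ?_) (genHouseholder_one_transpose_mul_self _)
    rw [diagOneBlock_transpose, diagOneBlock_mul, hp, diagOneBlock_one]
  · have hT := measurePreserving_householderBlock hν κ hU
    have hUmul : Measurable fun M : Matrix (Fin (n + 1)) (Fin (n + 1)) ℝ => U * M :=
      measurable_const.matrix_mul_matrix measurable_id
    rw [Measure.map_map hUmul hF]
    refine Eq.trans ?_ (congrArg (Measure.map F) hT.map_eq)
    rw [Measure.map_map hF hT.measurable]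
    refine Measure.map_congr ?_
    have h : ∀ᵐ p ∂P, p.1.1 ≠ 0 :=
      Measure.quasiMeasurePreserving_fst.ae
        (Measure.quasiMeasurePreserving_fst.ae (stdGaussianVec_ae_ne_zero n))
    filter_upwards [h] with p hp
    simp only [F, Function.comp_apply]
    rw [← diagOneBlock_mul, ← Matrix.mul_assoc (genHouseholder 1 (U *ᵥ p.1.1)),
      genHouseholder_mul_diagOneBlock_householderBlock hU hp]
    simp only [Matrix.mul_assoc]

end
end
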